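/- Let n ≥ 1 and let F ∈ ℂ[X_0,…,X_{n+1}] be homogeneous of degree d ≥ 1 such that the partial derivatives ∂F/∂X_0,…,∂F/∂X_{n+1} have no common zero in ℂ^{n+2} other than the origin (V(F) ⊂ ℙ^{n+1} smooth). Then dim_ℂ R_{2d−n−2} = c_d, where c_d = C(2d−1, n+1) − (n+2)·C(d, n+1) and C(·,·) denotes the binomial coefficient (with C(m,k) = 0 for m < k). -/

import Mathlib

open MvPolynomial

/-- The space `S_k` of homogeneous polynomials of (integer) degree `k`,
with `S_k = 0` for `k < 0`. -/
noncomputable def gradedPiece (n : ℕ) (k : ℤ) :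
    Submodule ℂ (MvPolynomial (Fin (n + 2)) ℂ) :=
  if 0 ≤ k then homogeneousSubmodule (Fin (n + 2)) ℂ k.toNat else ⊥

/-- The Jacobian ideal of `F`, generated by its partial derivatives. -/
noncomputable def jacobianIdeal (n : ℕ) (F : MvPolynomial (Fin (n + 2)) ℂ) :
    Ideal (MvPolynomial (Fin (n + 2)) ℂ) :=
  Ideal.span (Set.range fun i => pderiv i F)

/-- The graded piece `R_k = S_k/(J(F) ∩ S_k)` of the Jacobian ring in (integer)
degree `k`, realized as the image of `S_k` in `S/J(F)`. -/
noncomputable def jacobianRingPiece (n : ℕ) (F : MvPolynomial (Fin (n + 2)) ℂ) (k : ℤ) :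
    Submodule ℂ (MvPolynomial (Fin (n + 2)) ℂ ⧸
      Submodule.restrictScalars ℂ (jacobianIdeal n F)) :=
  Submodule.map (Submodule.restrictScalars ℂ (jacobianIdeal n F)).mkQ (gradedPiece n k)

namespace KoszulAux
open ExteriorAlgebra
variable {R M : Type*} [CommRing R] [AddCommGroup M] [Module R M]

noncomputable def dd (φ : Module.Dual R M) : ExteriorAlgebra R M →ₗ[R] ExteriorAlgebra R M :=
  CliffordAlgebra.contractLeft (Q := (0 : QuadraticForm R M)) φ

lemma dd_ι_mul (φ : Module.Dual R M) (v : M) (b : ExteriorAlgebra R M) :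
    dd φ (ι R v * b) = φ v • b - ι R v * dd φ b :=
  CliffordAlgebra.contractLeft_ι_mul (Q := (0 : QuadraticForm R M)) (d := φ) v b

lemma dd_dd (φ : Module.Dual R M) (b : ExteriorAlgebra R M) : dd φ (dd φ b) = 0 :=
  CliffordAlgebra.contractLeft_contractLeft (Q := (0 : QuadraticForm R M)) φ b

lemma dd_ι (φ : Module.Dual R M) (v : M) : dd φ (ι R v) = algebraMap R _ (φ v) :=
  CliffordAlgebra.contractLeft_ι (Q := (0 : QuadraticForm R M)) φ v

lemma ι_mul_mem (v : M) (j : ℕ) {b : ExteriorAlgebra R M} (hb : b ∈ ⋀[R]^j M) :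
    ι R v * b ∈ ⋀[R]^(j+1) M := by
  show _ ∈ (LinearMap.range (ι R (M := M)))^(j+1)
  rw [pow_succ']
  exact Submodule.mul_mem_mul ⟨v, rfl⟩ hb

lemma ext_induction {j : ℕ} {p : ExteriorAlgebra R M → Prop}
    (h : ∀ v, ∀ b ∈ ⋀[R]^j M, p (ι R v * b)) (hadd : ∀ x y, p x → p y → p (x + y))
    {z : ExteriorAlgebra R M} (hz : z ∈ ⋀[R]^(j+1) M) : p z := by
  change _ ∈ (LinearMap.range (ι R (M := M)))^(j+1) at hz
  rw [pow_succ'] at hz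
  induction hz using Submodule.mul_induction_on' with
  | mem_mul_mem m hm n hn => obtain ⟨v, rfl⟩ := hm; exact h v n hn
  | add x _ y _ hx hy => exact hadd _ _ hx hy

lemma dd_mem (φ : Module.Dual R M) (j : ℕ) {z : ExteriorAlgebra R M} (hz : z ∈ ⋀[R]^(j+1) M) :
    dd φ z ∈ ⋀[R]^j M := by
  induction j generalizing z with
  | zero =>
    refine ext_induction (p := fun z => dd φ z ∈ ⋀[R]^0 M) ?_ ?_ hz
    · intro v b hb
      have hb' : b ∈ (LinearMap.range (ι R (M := M)))^0 := hb
      rw [pow_zero, Submodule.mem_one] at hb'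
      obtain ⟨r, rfl⟩ := hb'
      rw [dd_ι_mul]
      have : dd φ (algebraMap R (ExteriorAlgebra R M) r) = 0 :=
        CliffordAlgebra.contractLeft_algebraMap (Q := (0 : QuadraticForm R M)) φ r
      rw [this, mul_zero, sub_zero]
      exact Submodule.smul_mem _ _ hb
    · intro x y hx hy
      rw [map_add]; exact Submodule.add_mem _ hx hy
  | succ j ih =>
    refine ext_induction (p := fun z => dd φ z ∈ ⋀[R]^(j+1) M) ?_ ?_ hz
    · intro v b hb
      rw [dd_ι_mul]
      exact Submodule.sub_mem _ (Submodule.smul_mem _ _ hb) (ι_mul_mem v j (ih hb))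
    · intro x y hx hy
      rw [map_add]; exact Submodule.add_mem _ hx hy

lemma dd_mem_smul (φ : Module.Dual R M) (I : Ideal R) (j : ℕ) {z : ExteriorAlgebra R M}
    (hz : z ∈ I • ⋀[R]^(j+1) M) : dd φ z ∈ I • ⋀[R]^j M := by
  induction hz using Submodule.smul_induction_on' with
  | smul r hr n hn => rw [map_smul]; exact Submodule.smul_mem_smul hr (dd_mem φ j hn)
  | add x _ y _ hx hy => rw [map_add]; exact Submodule.add_mem _ hx hy

lemma ι_mul_mem_smul (v : M) (I : Ideal R) (j : ℕ) {z : ExteriorAlgebra R M}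
    (hz : z ∈ I • ⋀[R]^j M) : ι R v * z ∈ I • ⋀[R]^(j+1) M := by
  induction hz using Submodule.smul_induction_on' with
  | smul r hr n hn => rw [mul_smul_comm]; exact Submodule.smul_mem_smul hr (ι_mul_mem v j hn)
  | add x _ y _ hx hy => rw [mul_add]; exact Submodule.add_mem _ hx hy

lemma dd_mem_range (φ : Module.Dual R M) (j : ℕ) {z : ExteriorAlgebra R M}
    (hz : z ∈ ⋀[R]^(j+2) M) : dd φ z ∈ (LinearMap.range φ : Ideal R) • ⋀[R]^(j+1) M := by
  induction j generalizing z with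
  | zero =>
    refine ext_induction (p := fun z => dd φ z ∈ (LinearMap.range φ : Ideal R) • ⋀[R]^1 M)
      ?_ ?_ hz
    · intro v b hb
      rw [dd_ι_mul]
      refine Submodule.sub_mem _ (Submodule.smul_mem_smul ⟨v, rfl⟩ hb) ?_
      have hb1 : b ∈ LinearMap.range (ι R (M := M)) := by
        have hb' : b ∈ (LinearMap.range (ι R (M := M)))^1 := hb
        rwa [pow_one] at hb'
      obtain ⟨u, rfl⟩ := hb1
      rw [dd_ι, ← Algebra.commutes, ← Algebra.smul_def]
      refine Submodule.smul_mem_smul ⟨u, rfl⟩ ?_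
      show _ ∈ (LinearMap.range (ι R (M := M)))^1
      rw [pow_one]; exact ⟨v, rfl⟩
    · intro x y hx hy
      rw [map_add]; exact Submodule.add_mem _ hx hy
  | succ j ih =>
    refine ext_induction (p := fun z => dd φ z ∈ (LinearMap.range φ : Ideal R) • ⋀[R]^(j+2) M)
      ?_ ?_ hz
    · intro v b hb
      rw [dd_ι_mul]
      exact Submodule.sub_mem _ (Submodule.smul_mem_smul ⟨v, rfl⟩ hb) (ι_mul_mem_smul v _ _ (ih hb))
    · intro x y hx hy
      rw [map_add]; exact Submodule.add_mem _ hx hy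

/-- Cancellation of a nonzerodivisor modulo `I` on a free module. -/
lemma cancel_free {P : Type*} [AddCommGroup P] [Module R P] [Module.Free R P] (I : Ideal R) (a : R)
    (ha : ∀ p, a * p ∈ I → p ∈ I) (z : P) (hz : a • z ∈ I • (⊤ : Submodule R P)) :
    z ∈ I • (⊤ : Submodule R P) := by
  let b := Module.Free.chooseBasis R P
  have key : ∀ y ∈ I • (⊤ : Submodule R P), ∀ i, b.repr y i ∈ I := by
    intro y hy i
    induction hy using Submodule.smul_induction_on' with
    | smul r hr n hn => simpa using I.mul_mem_right _ hr
    | add x _ y _ hx hy => simpa using I.add_mem hx hy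
  rw [← b.linearCombination_repr z, Finsupp.linearCombination_apply]
  refine Submodule.sum_mem _ fun i _ => Submodule.smul_mem_smul (ha _ ?_) trivial
  simpa using key _ hz i

lemma cancel [Module.Free R M] (I : Ideal R) (a : R) (ha : ∀ p, a * p ∈ I → p ∈ I) (j : ℕ)
    {z : ExteriorAlgebra R M} (hz : z ∈ ⋀[R]^j M) (h : a • z ∈ I • ⋀[R]^j M) :
    z ∈ I • ⋀[R]^j M := by
  have h1 := (Submodule.mem_smul_top_iff I (⋀[R]^j M) (a • ⟨z, hz⟩)).2 h
  exact (Submodule.mem_smul_top_iff I (⋀[R]^j M) ⟨z, hz⟩).1 (cancel_free I a ha _ h1)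

/-- exactness of the Koszul complex at spot `j` modulo `I`. -/
def Ex (φ : Module.Dual R M) (I : Ideal R) (j : ℕ) : Prop :=
  ∀ z ∈ ⋀[R]^(j+1) M, dd φ z ∈ I • ⋀[R]^j M →
    ∃ w ∈ ⋀[R]^(j+2) M, z - dd φ w ∈ I • ⋀[R]^(j+1) M

lemma Ex_step [Module.Free R M] (φ : Module.Dual R M) (I : Ideal R) (v : M)
    (ha : ∀ p, φ v * p ∈ I → p ∈ I) (j : ℕ) (h : Ex φ (I ⊔ Ideal.span {φ v}) (j+1)) :
    Ex φ I j := by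
  intro z hz hdz
  have hy : dd φ (ι R v * z) ∈ (I ⊔ Ideal.span {φ v}) • ⋀[R]^(j+1) M := by
    rw [dd_ι_mul]
    refine Submodule.sub_mem _ (Submodule.smul_mem_smul ?_ hz) ?_
    · exact Ideal.mem_sup_right (Ideal.mem_span_singleton_self _)
    · exact Submodule.smul_mono_left le_sup_left (ι_mul_mem_smul v I j hdz)
  obtain ⟨w, hw, hu⟩ := h _ (ι_mul_mem v _ hz) hy
  rw [Submodule.sup_smul, Submodule.mem_sup] at hu
  obtain ⟨u2, hu2, u1, hu1, hu⟩ := hu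
  rw [Submodule.ideal_span_singleton_smul] at hu1
  obtain ⟨u', hu', rfl⟩ := hu1
  refine ⟨u', hu', ?_⟩
  refine cancel I (φ v) ha _ (Submodule.sub_mem _ hz (dd_mem φ _ hu')) ?_
  have e := congrArg (dd φ) hu
  simp only [map_add, map_sub, dd_dd, dd_ι_mul, sub_zero] at e
  have e2 : φ v • (z - dd φ u') = dd φ u2 + ι R v * dd φ z := by
    have e3 : dd φ (φ v • u') = φ v • dd φ u' := map_smul _ _ _
    change dd φ u2 + dd φ (φ v • u') = _ at e
    rw [smul_sub, ← e3]
    rw [eq_sub_iff_add_eq] at e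
    rw [← e]; abel
  rw [e2]
  exact Submodule.add_mem _ (dd_mem_smul φ I _ hu2) (ι_mul_mem_smul v I j hdz)

lemma ext_top [Nontrivial R] [Module.Free R M] [Module.Finite R M] (j : ℕ) (hj : Module.finrank R M < j)
    {z : ExteriorAlgebra R M} (hz : z ∈ ⋀[R]^j M) : z = 0 := by
  have h : Module.finrank R (⋀[R]^j M) = 0 := by
    rw [exteriorPower.finrank_eq, Nat.choose_eq_zero_of_lt hj]
  have : Subsingleton (⋀[R]^j M) := by
    exact (Module.finrank_eq_zero_iff_of_free R _).1 h
  exact congrArg Subtype.val (Subsingleton.elim (⟨z, hz⟩ : ⋀[R]^j M) 0)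

lemma Ex_zero [Nontrivial R] [Module.Free R M] [Module.Finite R M] (φ : Module.Dual R M)
    (I : ℕ → Ideal R) (v : ℕ → M) (hI : ∀ k < Module.finrank R M, I (k+1) = I k ⊔ Ideal.span {φ (v k)})
    (ha : ∀ k < Module.finrank R M, ∀ p, φ (v k) * p ∈ I k → p ∈ I k) : Ex φ (I 0) 0 := by
  have key : ∀ i, i ≤ Module.finrank R M → Ex φ (I (Module.finrank R M - i)) (Module.finrank R M - i) := by
    intro i
    induction i with
    | zero =>
      intro _ z hz _
      rw [ext_top _ (by simp) hz]
      exact ⟨0, Submodule.zero_mem _, by simp⟩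
    | succ i ih =>
      intro hi
      have := ih (by omega)
      obtain ⟨k, hk⟩ : ∃ k, Module.finrank R M - i = k + 1 := ⟨Module.finrank R M - i - 1, by omega⟩
      rw [hk, hI k (by omega)] at this
      rw [show Module.finrank R M - (i+1) = k by omega]
      exact Ex_step φ _ (v k) (ha k (by omega)) k this
  simpa using key _ le_rfl

theorem syz {N : ℕ} [Nontrivial R] (f : Fin N → R) (I : ℕ → Ideal R) (a : ℕ → R) (hI0 : I 0 = ⊥)
    (hf : ∀ k < N, a k ∈ Ideal.span (Set.range f))
    (hI : ∀ k < N, I (k+1) = I k ⊔ Ideal.span {a k})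
    (ha : ∀ k < N, ∀ p, a k * p ∈ I k → p ∈ I k) (g : Fin N → R) (hg : ∑ i, g i * f i = 0) (i : Fin N) :
    g i ∈ Ideal.span (Set.range f) := by
  let φ : Module.Dual R (Fin N → R) := Fintype.linearCombination R f
  have hr : (LinearMap.range φ : Ideal R) = Ideal.span (Set.range f) :=
    Fintype.range_linearCombination R f
  have hv : ∀ k, ∃ v, k < N → φ v = a k := by
    intro k
    by_cases hk : k < N
    · have := hf k hk
      rw [← hr] at this
      obtain ⟨v, hv⟩ := this
      exact ⟨v, fun _ => hv⟩
    · exact ⟨0, fun h => absurd h hk⟩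
  choose v hv using hv
  have hE : Ex φ (I 0) 0 := by
    refine Ex_zero φ I v ?_ ?_
    · intro k hk
      simp only [Module.finrank_fin_fun] at hk
      rw [hv k hk]; exact hI k hk
    · intro k hk
      simp only [Module.finrank_fin_fun] at hk
      rw [hv k hk]; exact ha k hk
  have h1 : ι R g ∈ ⋀[R]^1 (Fin N → R) := by
    show _ ∈ (LinearMap.range (ι R (M := Fin N → R)))^1
    rw [pow_one]; exact ⟨g, rfl⟩
  obtain ⟨w, hw, hz⟩ := hE (ι R g) h1 (by
    rw [dd_ι]
    have : φ g = 0 := by simpa [φ, Fintype.linearCombination_apply] using hg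
    rw [this, map_zero]; exact Submodule.zero_mem _)
  rw [hI0, Submodule.bot_smul, Submodule.mem_bot, sub_eq_zero] at hz
  have h2 := dd_mem_range φ 0 hw
  rw [← hz, hr] at h2
  have h3 : (⋀[R]^(0+1) (Fin N → R)) = Submodule.map (ι R) ⊤ := by
    rw [← LinearMap.range_eq_map]; exact pow_one _
  rw [h3, ← Submodule.map_smul''] at h2
  obtain ⟨g', hg', e⟩ := h2
  have e' : g' = g := ExteriorAlgebra.ι_leftInverse.injective e
  subst e'
  clear e h1 hz hg
  change g' ∈ Ideal.span (Set.range f) • (⊤ : Submodule R (Fin N → R)) at hg'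
  induction hg' using Submodule.smul_induction_on' with
  | smul r hr n hn => simpa using Ideal.mul_mem_right _ _ hr
  | add x _ y _ hx hy => simpa using Ideal.add_mem _ hx hy
end KoszulAux

namespace JacAux
open MvPolynomial

lemma finrank_homog (n k : ℕ) :
    Module.finrank ℂ (homogeneousSubmodule (Fin (n+2)) ℂ k) = (k + n + 1).choose (n+1) := by
  rw [homogeneousSubmodule_eq_finsupp_supported,
    (AddMonoidAlgebra.supportedEquivFinsupp (S := ℂ) (R := ℂ) {d : Fin (n+2) →₀ ℕ | d.degree = k}).finrank_eq]
  have hs : {d : Fin (n+2) →₀ ℕ | d.degree = k} = ↑((Finset.univ : Finset (Fin (n+2))).finsuppAntidiag k) := by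
    ext d
    simp [Finset.mem_finsuppAntidiag, Finsupp.degree_eq_sum]
  rw [hs, Module.finrank_finsupp_self]
  rw [← Nat.card_eq_fintype_card, Nat.card_coe_set_eq, Set.ncard_coe_finset, Finset.card_finsuppAntidiag_nat_eq_choose]
  rw [Finset.card_univ, Fintype.card_fin, show n + 2 + k - 1 = k + (n + 1) by omega, Nat.choose_symm_add]
  rfl

instance (n k : ℕ) : Module.Finite ℂ (homogeneousSubmodule (Fin (n+2)) ℂ k) :=
  Module.Finite.iff_fg.2 (homogeneousSubmodule_fg _ _ k)

lemma hc_mul {n e k : ℕ} (f : MvPolynomial (Fin (n+2)) ℂ) (hf : f.IsHomogeneous e)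
    (g : MvPolynomial (Fin (n+2)) ℂ) :
    homogeneousComponent k (g * f) = if e ≤ k then homogeneousComponent (k - e) g * f else 0 := by
  induction g using MvPolynomial.induction_on' with
  | monomial s c =>
    have h1 : (monomial s c : MvPolynomial (Fin (n+2)) ℂ).IsHomogeneous s.degree :=
      isHomogeneous_monomial c rfl
    rw [homogeneousComponent_of_mem (h1.mul hf), homogeneousComponent_of_mem h1]
    by_cases h : e ≤ k
    · by_cases h2 : k = s.degree + e
      · rw [if_pos h2, if_pos h, if_pos (by omega)]
      · rw [if_neg h2, if_pos h, if_neg (by omega), zero_mul]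
    · rw [if_neg h, if_neg (by omega)]
  | add p q hp hq =>
    rw [add_mul, map_add, hp, hq]
    split_ifs <;> simp [add_mul]

/-- elements of the ideal generated by degree `e` forms have no components in degree `< e`. -/
lemma small_eq_zero {n e k N : ℕ} (f : Fin N → MvPolynomial (Fin (n+2)) ℂ)
    (hf : ∀ i, (f i).IsHomogeneous e) (hk : k < e) (p : MvPolynomial (Fin (n+2)) ℂ)
    (hp : p ∈ Ideal.span (Set.range f)) (hpk : p.IsHomogeneous k) : p = 0 := by
  obtain ⟨c, rfl⟩ := Ideal.mem_span_range_iff_exists_fun.1 hp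
  rw [← homogeneousComponent_eq_self hpk, map_sum]
  refine Finset.sum_eq_zero fun i _ => ?_
  rw [hc_mul _ (hf i), if_neg (by omega)]

lemma syz_zero {n e l : ℕ} (f : Fin (n+2) → MvPolynomial (Fin (n+2)) ℂ)
    (hf : ∀ i, (f i).IsHomogeneous e) (hl : l < e)
    (hsm : ∀ x : Fin (n + 2) → ℂ, (∀ i, eval x (f i) = 0) → x = 0)
    (g : Fin (n+2) → MvPolynomial (Fin (n+2)) ℂ) (hg : ∀ i, (g i).IsHomogeneous l)
    (h : ∑ i, g i * f i = 0) (i : Fin (n+2)) : g i = 0 := by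
  refine small_eq_zero f hf hl _ ?_ (hg i)
  have hX : ∀ i : Fin (n+2), ∃ m : ℕ, (X i : MvPolynomial (Fin (n+2)) ℂ)^m ∈ Ideal.span (Set.range f) := by
    intro i
    have : (X i : MvPolynomial (Fin (n+2)) ℂ) ∈ (Ideal.span (Set.range f)).radical := by
      rw [← vanishingIdeal_zeroLocus_eq_radical (K := ℂ), mem_vanishingIdeal_iff]
      intro x hx
      rw [zeroLocus_span] at hx
      have hx0 : x = 0 := hsm x fun i => by
        have := hx (f i) ⟨i, rfl⟩
        rwa [aeval_eq_eval] at this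
      simp [hx0]
    exact this
  choose m hm using hX
  let I : ℕ → Ideal (MvPolynomial (Fin (n+2)) ℂ) := fun k =>
    Ideal.span ((fun s => monomial s (1 : ℂ)) '' ((fun i => Finsupp.single i (m i)) '' {i : Fin (n+2) | i.val < k}))
  let a : ℕ → MvPolynomial (Fin (n+2)) ℂ := fun k => if hk : k < n + 2 then X ⟨k, hk⟩ ^ m ⟨k, hk⟩ else 0
  refine KoszulAux.syz f I a ?_ ?_ ?_ ?_ g h i
  · simp [I]
  · intro k hk
    simp only [a, dif_pos hk]
    exact hm _
  · intro k hk
    simp only [a, dif_pos hk, I]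
    rw [← Ideal.span_union]
    congr 1
    have : {i : Fin (n+2) | i.val < k + 1} = {i | i.val < k} ∪ {⟨k, hk⟩} := by
      ext i
      simp [Fin.ext_iff]; omega
    rw [this, Set.image_union, Set.image_union]
    simp [X_pow_eq_monomial]
  · intro k hk p hp
    simp only [a, dif_pos hk, I] at hp ⊢
    rw [mem_ideal_span_monomial_image] at hp ⊢
    intro s hs
    obtain ⟨_, ⟨i, hi, rfl⟩, hle⟩ := hp (Finsupp.single ⟨k, hk⟩ (m ⟨k, hk⟩) + s) (by
      rw [mem_support_iff, X_pow_eq_monomial, coeff_monomial_mul, one_mul]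
      exact mem_support_iff.1 hs)
    refine ⟨_, ⟨i, hi, rfl⟩, ?_⟩
    simp only [Finsupp.single_le_iff, Finsupp.add_apply] at hle ⊢
    rwa [Finsupp.single_eq_of_ne, zero_add] at hle
    intro h
    subst h
    simp at hi

lemma finrank_map_add {V W : Type*} [AddCommGroup V] [Module ℂ V] [AddCommGroup W] [Module ℂ W]
    (A : Submodule ℂ V) [Module.Finite ℂ A] (f : V →ₗ[ℂ] W) :
    Module.finrank ℂ (A.map f) + Module.finrank ℂ (A ⊓ LinearMap.ker f : Submodule ℂ V) = Module.finrank ℂ A := by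
  have h := LinearMap.finrank_range_add_finrank_ker (f.domRestrict A)
  rw [LinearMap.range_domRestrict] at h
  rw [← h, ← Submodule.finrank_map_subtype_eq A (LinearMap.ker (f.domRestrict A))]
  rw [LinearMap.ker_domRestrict, Submodule.map_comap_subtype]

lemma finrank_inf {n e l : ℕ} (f : Fin (n+2) → MvPolynomial (Fin (n+2)) ℂ)
    (hf : ∀ i, (f i).IsHomogeneous e) (hl : l < e)
    (hsm : ∀ x : Fin (n + 2) → ℂ, (∀ i, eval x (f i) = 0) → x = 0) :
    Module.finrank ℂ (homogeneousSubmodule (Fin (n+2)) ℂ (l + e) ⊓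
      Submodule.restrictScalars ℂ (Ideal.span (Set.range f)) : Submodule ℂ (MvPolynomial (Fin (n+2)) ℂ))
      = (n + 2) * (l + n + 1).choose (n+1) := by
  let T : (Fin (n+2) → homogeneousSubmodule (Fin (n+2)) ℂ l) →ₗ[ℂ] MvPolynomial (Fin (n+2)) ℂ :=
    { toFun := fun g => ∑ i, (g i : MvPolynomial (Fin (n+2)) ℂ) * f i
      map_add' := fun x y => by simp [add_mul, Finset.sum_add_distrib]
      map_smul' := fun c x => by simp [Finset.smul_sum] }
  have hT : LinearMap.range T = homogeneousSubmodule (Fin (n+2)) ℂ (l + e) ⊓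
      Submodule.restrictScalars ℂ (Ideal.span (Set.range f)) := by
    ext p
    constructor
    · rintro ⟨g, rfl⟩
      have h1 : (∑ i, (g i : MvPolynomial (Fin (n+2)) ℂ) * f i) ∈
          homogeneousSubmodule (Fin (n+2)) ℂ (l + e) :=
        Submodule.sum_mem _ fun i _ => (g i).2.mul (hf i)
      refine ⟨h1, ?_⟩
      show (∑ i, (g i : MvPolynomial (Fin (n+2)) ℂ) * f i) ∈ Ideal.span (Set.range f)
      exact Submodule.sum_mem _ fun i _ => Ideal.mul_mem_left _ _ (Ideal.subset_span ⟨i, rfl⟩)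
    · rintro ⟨h1, h2⟩
      obtain ⟨c, rfl⟩ := Ideal.mem_span_range_iff_exists_fun.1 h2
      refine ⟨fun i => ⟨homogeneousComponent l (c i), homogeneousComponent_mem _ _⟩, ?_⟩
      rw [← homogeneousComponent_eq_self h1, map_sum]
      show ∑ i, homogeneousComponent l (c i) * f i = _
      refine Finset.sum_congr rfl fun i _ => ?_
      rw [hc_mul _ (hf i), if_pos (by omega), Nat.add_sub_cancel]
  have hinj : Function.Injective T := by
    rw [← LinearMap.ker_eq_bot, LinearMap.ker_eq_bot']
    intro g hg
    funext i
    exact Subtype.ext (syz_zero f hf hl hsm (fun i => g i) (fun i => (g i).2) hg i)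
  rw [← hT, LinearMap.finrank_range_of_inj hinj, Module.finrank_pi_fintype]
  simp [finrank_homog]
end JacAux

theorem dim_jacobian_ring_middle_piece_smooth
    (n d : ℕ) (hn : 1 ≤ n) (hd : 1 ≤ d)
    (F : MvPolynomial (Fin (n + 2)) ℂ) (hF : F.IsHomogeneous d)
    (hsm : ∀ x : Fin (n + 2) → ℂ, (∀ i, eval x (pderiv i F) = 0) → x = 0) :
    (Module.finrank ℂ (jacobianRingPiece n F (2 * (d : ℤ) - n - 2)) : ℤ) =
      ((2 * d - 1).choose (n + 1) : ℤ) - (n + 2) * (d.choose (n + 1) : ℤ) := by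
  have hf : ∀ i, (pderiv i F).IsHomogeneous (d - 1) := fun i => hF.pderiv
  unfold jacobianRingPiece
  by_cases h : 0 ≤ 2 * (d : ℤ) - n - 2
  · have hg : gradedPiece n (2 * (d : ℤ) - n - 2) =
        homogeneousSubmodule (Fin (n + 2)) ℂ (2 * (d : ℤ) - n - 2).toNat := if_pos h
    rw [hg]
    obtain ⟨K, hK⟩ := Int.eq_ofNat_of_zero_le h
    rw [hK, Int.toNat_natCast]
    have h1 := JacAux.finrank_map_add (homogeneousSubmodule (Fin (n+2)) ℂ K)
      (Submodule.restrictScalars ℂ (jacobianIdeal n F)).mkQ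
    rw [Submodule.ker_mkQ, JacAux.finrank_homog, show K + n + 1 = 2 * d - 1 by omega] at h1
    by_cases hKe : d - 1 ≤ K
    · obtain ⟨l, rfl⟩ := Nat.exists_eq_add_of_le' hKe
      have h2 := JacAux.finrank_inf (l := l) _ hf (by omega) hsm
      rw [show l + n + 1 = d by omega] at h2
      unfold jacobianIdeal at h1 ⊢
      rw [h2] at h1
      rw [← h1]; push_cast; ring
    · have h2 : homogeneousSubmodule (Fin (n+2)) ℂ K ⊓
          Submodule.restrictScalars ℂ (jacobianIdeal n F) = ⊥ := by
        rw [eq_bot_iff]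
        rintro p ⟨hp1, hp2⟩
        exact JacAux.small_eq_zero _ hf (by omega) p hp2 hp1
      rw [h2, finrank_bot, add_zero] at h1
      rw [h1, Nat.choose_eq_zero_of_lt (show d < n + 1 by omega)]
      simp
  · have hg : gradedPiece n (2 * (d : ℤ) - n - 2) = ⊥ := if_neg h
    rw [hg, Submodule.map_bot, finrank_bot, Nat.choose_eq_zero_of_lt (show d < n + 1 by omega),
      Nat.choose_eq_zero_of_lt (show 2 * d - 1 < n + 1 by omega)]
    simp
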